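/- Let Λ : ℕ → ℕ be a strictly increasing function. Then (1/(n log n)) ∑_{i=1}^{n} a_{Λ(i)}(x) converges to 1/log 2 in measure; that is, for every ε > 0, the Lebesgue measure of {x ∈ (0,1) irrational : |(1/(n log n)) ∑_{i=1}^{n} a_{Λ(i)}(x) − 1/log 2| > ε} tends to 0 as n → ∞. -/

import Mathlib

open MeasureTheory Filter Real

/-- The Gauss map `G(y) = 1/y - ⌊1/y⌋` (with `G 0 = 0`). -/
noncomputable def gaussMap (y : ℝ) : ℝ := Int.fract (1 / y)

/-- The `n`-th regular continued fraction digit `a_n(x) = ⌊1 / G^{n-1}(x)⌋`. -/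
noncomputable def rcfDigit (x : ℝ) (n : ℕ) : ℕ := (⌊1 / gaussMap^[n - 1] x⌋).toNat

/-- The probability that the first digit is `k + 1`, given that the remaining expansion is `x`. -/
noncomputable def gaussWeight (k : ℕ) (x : ℝ) : ℝ := (1 + x) / ((k + 1 + x) * (k + 2 + x))

/-- The transfer operator of the Gauss map with respect to the Gauss measure. -/
noncomputable def gaussTransfer (f : ℝ → ℝ) (x : ℝ) : ℝ :=
  ∑' k : ℕ, gaussWeight k x * f (1 / (k + 1 + x))

lemma gaussWeight_nonneg (k : ℕ) {x : ℝ} (hx : 0 ≤ x) : 0 ≤ gaussWeight k x := by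
  unfold gaussWeight; positivity

lemma sum_gaussWeight (n : ℕ) {x : ℝ} (hx : 0 ≤ x) :
    ∑ k ∈ Finset.range n, gaussWeight k x = 1 - (1 + x) / (n + 1 + x) := by
  induction n with
  | zero =>
    have : 1 + x ≠ 0 := by positivity
    simp [this]
  | succ n ih =>
    rw [Finset.sum_range_succ, ih, gaussWeight]
    have h1 : (n : ℝ) + 1 + x ≠ 0 := by positivity
    have h2 : (n : ℝ) + 2 + x ≠ 0 := by positivity
    have h3 : (n : ℝ) + 1 + 1 + x ≠ 0 := by positivity
    push_cast
    field_simp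
    ring

lemma hasSum_gaussWeight {x : ℝ} (hx : 0 ≤ x) : HasSum (fun k => gaussWeight k x) 1 := by
  rw [hasSum_iff_tendsto_nat_of_nonneg fun k => gaussWeight_nonneg k hx]
  simp_rw [sum_gaussWeight _ hx]
  have h : Tendsto (fun n : ℕ => (n : ℝ) + (1 + x)) atTop atTop :=
    tendsto_atTop_add_const_right _ _ tendsto_natCast_atTop_atTop
  simpa [add_assoc] using (h.const_div_atTop (1 + x)).const_sub 1

lemma inv_branch_mem_Icc (k : ℕ) {x : ℝ} (hx : 0 ≤ x) :
    1 / ((k : ℝ) + 1 + x) ∈ Set.Icc (0 : ℝ) 1 := by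
  have h : (0 : ℝ) ≤ k := k.cast_nonneg
  refine ⟨by positivity, ?_⟩
  rw [div_le_one (by positivity)]
  linarith

lemma inv_branch_antitone (k : ℕ) {x y : ℝ} (hx : 0 ≤ x) (hxy : x ≤ y) :
    1 / ((k : ℝ) + 1 + y) ≤ 1 / (k + 1 + x) :=
  one_div_le_one_div_of_le (by positivity) (by linarith)

lemma summable_gaussTransfer {f : ℝ → ℝ} {M : ℝ} (hf : ∀ x ∈ Set.Icc (0 : ℝ) 1, f x ∈ Set.Icc 0 M)
    {x : ℝ} (hx : 0 ≤ x) : Summable fun k : ℕ => gaussWeight k x * f (1 / (k + 1 + x)) := by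
  refine Summable.of_nonneg_of_le (fun k => ?_) (fun k => ?_)
    ((hasSum_gaussWeight hx).summable.mul_right M)
  · exact mul_nonneg (gaussWeight_nonneg k hx) (hf _ (inv_branch_mem_Icc k hx)).1
  · exact mul_le_mul_of_nonneg_left (hf _ (inv_branch_mem_Icc k hx)).2 (gaussWeight_nonneg k hx)

lemma gaussTransfer_mem_Icc {f : ℝ → ℝ} {m M : ℝ} (hm : 0 ≤ m)
    (hf : ∀ x ∈ Set.Icc (0 : ℝ) 1, f x ∈ Set.Icc m M) {x : ℝ} (hx : 0 ≤ x) :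
    gaussTransfer f x ∈ Set.Icc m M := by
  have hs := summable_gaussTransfer (fun y hy => ⟨hm.trans (hf y hy).1, (hf y hy).2⟩) hx
  have hw := hasSum_gaussWeight hx
  constructor
  · have h := hw.mul_right m
    rw [one_mul] at h
    exact hasSum_le (fun k => mul_le_mul_of_nonneg_left (hf _ (inv_branch_mem_Icc k hx)).1
      (gaussWeight_nonneg k hx)) h hs.hasSum
  · have h := hw.mul_right M
    rw [one_mul] at h
    exact hasSum_le (fun k => mul_le_mul_of_nonneg_left (hf _ (inv_branch_mem_Icc k hx)).2
      (gaussWeight_nonneg k hx)) hs.hasSum h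

lemma sum_range_mul_eq_sum_partial (p g : ℕ → ℝ) (n : ℕ) :
    ∑ k ∈ Finset.range n, p k * g k = (∑ k ∈ Finset.range n, p k) * g n +
      ∑ k ∈ Finset.range n, (∑ j ∈ Finset.range (k + 1), p j) * (g k - g (k + 1)) := by
  induction n with
  | zero => simp
  | succ n ih =>
    simp only [Finset.sum_range_succ _ n, ih]
    ring

lemma sum_range_mul_le_of_partial_le {p q g : ℕ → ℝ} (hg : Antitone g) (hg0 : ∀ k, 0 ≤ g k)
    (hpq : ∀ n, ∑ k ∈ Finset.range n, p k ≤ ∑ k ∈ Finset.range n, q k) (n : ℕ) :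
    ∑ k ∈ Finset.range n, p k * g k ≤ ∑ k ∈ Finset.range n, q k * g k := by
  rw [sum_range_mul_eq_sum_partial p, sum_range_mul_eq_sum_partial q]
  exact add_le_add (mul_le_mul_of_nonneg_right (hpq n) (hg0 n)) (Finset.sum_le_sum fun k _ =>
    mul_le_mul_of_nonneg_right (hpq _) (sub_nonneg.2 (hg (Nat.le_succ k))))

lemma gaussTransfer_antitoneOn {f : ℝ → ℝ} (hf : MonotoneOn f (Set.Icc 0 1)) (h0 : 0 ≤ f 0) :
    AntitoneOn (gaussTransfer f) (Set.Icc 0 1) := by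
  have hb : ∀ x ∈ Set.Icc (0 : ℝ) 1, f x ∈ Set.Icc 0 (f 1) := fun x hx =>
    ⟨h0.trans (hf (by simp) hx hx.1), hf hx (by simp) hx.2⟩
  intro x hx y hy hxy
  refine le_of_tendsto_of_tendsto' (summable_gaussTransfer hb hy.1).hasSum.tendsto_sum_nat
    (summable_gaussTransfer hb hx.1).hasSum.tendsto_sum_nat fun n => ?_
  calc ∑ k ∈ Finset.range n, gaussWeight k y * f (1 / (k + 1 + y))
      ≤ ∑ k ∈ Finset.range n, gaussWeight k x * f (1 / (k + 1 + y)) := by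
        refine sum_range_mul_le_of_partial_le (g := fun k : ℕ => f (1 / (k + 1 + y))) ?_ ?_ ?_ n
        · refine antitone_nat_of_succ_le fun k => ?_
          refine hf (inv_branch_mem_Icc _ hy.1) (inv_branch_mem_Icc _ hy.1) ?_
          have := hy.1
          push_cast
          exact one_div_le_one_div_of_le (by positivity) (by linarith)
        · exact fun k => (hb _ (inv_branch_mem_Icc k hy.1)).1
        · intro m
          rw [sum_gaussWeight m hx.1, sum_gaussWeight m hy.1]
          have := hx.1
          have := hy.1
          have hm : (0 : ℝ) ≤ m := m.cast_nonneg
          have : (1 + x) / (m + 1 + x) ≤ (1 + y) / (m + 1 + y) := by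
            rw [div_le_div_iff₀ (by positivity) (by positivity)]
            nlinarith
          linarith
    _ ≤ ∑ k ∈ Finset.range n, gaussWeight k x * f (1 / (k + 1 + x)) := by
        gcongr with k
        · exact gaussWeight_nonneg k hx.1
        · exact hf (inv_branch_mem_Icc _ hy.1) (inv_branch_mem_Icc _ hx.1)
            (inv_branch_antitone k hx.1 hxy)

lemma gaussTransfer_monotoneOn {f : ℝ → ℝ} (hf : AntitoneOn f (Set.Icc 0 1)) (h1 : 0 ≤ f 1) :
    MonotoneOn (gaussTransfer f) (Set.Icc 0 1) := by
  have hb : ∀ x ∈ Set.Icc (0 : ℝ) 1, f x ∈ Set.Icc 0 (f 0) := fun x hx =>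
    ⟨h1.trans (hf hx (by simp) hx.2), hf (by simp) hx hx.1⟩
  have key : ∀ x ∈ Set.Icc (0 : ℝ) 1, gaussTransfer (fun z => f 0 - f z) x =
      f 0 - gaussTransfer f x := by
    intro x hx
    have h := ((hasSum_gaussWeight hx.1).mul_right (f 0)).sub
      (summable_gaussTransfer hb hx.1).hasSum
    simp_rw [← mul_sub, one_mul] at h
    exact h.tsum_eq
  have h := gaussTransfer_antitoneOn (f := fun z => f 0 - f z)
    (fun x hx y hy hxy => sub_le_sub_left (hf hx hy hxy) _) (by simp)
  intro x hx y hy hxy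
  have := h hx hy hxy
  rw [key x hx, key y hy] at this
  linarith

lemma gaussTransfer_zero {f : ℝ → ℝ} {M : ℝ} (hf : ∀ x ∈ Set.Icc (0 : ℝ) 1, f x ∈ Set.Icc 0 M) :
    gaussTransfer f 0 = (f 1 + gaussTransfer f 1) / 2 := by
  unfold gaussTransfer
  rw [(summable_gaussTransfer hf le_rfl).tsum_eq_zero_add, add_div, ← tsum_div_const]
  congr 1
  · norm_num [gaussWeight]
    ring
  · refine tsum_congr fun k => ?_
    have e : ((k + 1 : ℕ) : ℝ) + 1 + 0 = k + 1 + 1 := by push_cast; ring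
    rw [e, gaussWeight, gaussWeight]
    have h1 : (k : ℝ) + 2 ≠ 0 := by positivity
    have h2 : (k : ℝ) + 3 ≠ 0 := by positivity
    push_cast
    rw [mul_div_right_comm]
    congr 1
    ring_nf

/-- The transfer operator halves the oscillation of monotone functions. -/
lemma abs_gaussTransfer_sub_le {f : ℝ → ℝ} {D : ℝ}
    (hf0 : ∀ x ∈ Set.Icc (0 : ℝ) 1, 0 ≤ f x)
    (hf : MonotoneOn f (Set.Icc 0 1) ∨ AntitoneOn f (Set.Icc 0 1)) (hD : |f 0 - f 1| ≤ D) :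
    |gaussTransfer f 0 - gaussTransfer f 1| ≤ D / 2 := by
  have hb : ∀ x ∈ Set.Icc (0 : ℝ) 1, f x ∈ Set.uIcc (f 0) (f 1) := by
    intro x hx
    rcases hf with h | h
    · exact Set.Icc_subset_uIcc ⟨h (by simp) hx hx.1, h hx (by simp) hx.2⟩
    · exact Set.Icc_subset_uIcc' ⟨h hx (by simp) hx.2, h (by simp) hx hx.1⟩
  have hm : 0 ≤ min (f 0) (f 1) := le_min (hf0 0 (by simp)) (hf0 1 (by simp))
  have h1 := gaussTransfer_mem_Icc hm hb zero_le_one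
  rw [gaussTransfer_zero fun x hx => ⟨hf0 x hx, (hb x hx).2⟩]
  have h2 := Set.abs_sub_left_of_mem_uIcc (a := f 1) (b := f 0) (c := gaussTransfer f 1)
    (by rw [Set.uIcc_comm]; exact h1)
  rw [abs_sub_comm] at h2
  have e : (f 1 + gaussTransfer f 1) / 2 - gaussTransfer f 1 = (f 1 - gaussTransfer f 1) / 2 := by
    ring
  rw [e, abs_div, abs_two]
  linarith

open scoped ENNReal

/-- The transfer operator of the Gauss map, acting on `ℝ≥0∞`-valued functions. -/
noncomputable def gaussTransferENN (F : ℝ → ℝ≥0∞) (x : ℝ) : ℝ≥0∞ :=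
  ∑' k : ℕ, ENNReal.ofReal (gaussWeight k x) * F (1 / (k + 1 + x))

/-- The density of the Gauss measure. -/
noncomputable def gaussDensity (x : ℝ) : ℝ := 1 / (Real.log 2 * (1 + x))

/-- The Gauss measure on `(0, 1)`. -/
noncomputable def gaussMeasure : Measure ℝ :=
  (volume.restrict (Set.Ioo 0 1)).withDensity fun x => ENNReal.ofReal (gaussDensity x)

lemma measurable_gaussMap : Measurable gaussMap := by
  unfold gaussMap; fun_prop

lemma measurable_gaussWeight (k : ℕ) : Measurable (gaussWeight k) := by
  unfold gaussWeight; fun_prop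

lemma measurable_gaussDensity : Measurable gaussDensity := by
  unfold gaussDensity; fun_prop

lemma measurable_gaussTransferENN {F : ℝ → ℝ≥0∞} (hF : Measurable F) :
    Measurable (gaussTransferENN F) := by
  refine Measurable.tsum fun k => ?_
  have := (measurable_gaussWeight k).ennreal_ofReal
  fun_prop

lemma lintegral_gaussMeasure {F : ℝ → ℝ≥0∞} (hF : Measurable F) :
    ∫⁻ x, F x ∂gaussMeasure = ∫⁻ x in Set.Ioo 0 1, ENNReal.ofReal (gaussDensity x) * F x :=
  lintegral_withDensity_eq_lintegral_mul _ measurable_gaussDensity.ennreal_ofReal hF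

lemma inv_branch_image (k : ℕ) :
    (fun y : ℝ => 1 / (k + 1 + y)) '' Set.Ico 0 1 = Set.Ioc (1 / (k + 2) : ℝ) (1 / (k + 1)) := by
  ext x
  simp only [Set.mem_image, Set.mem_Ico, Set.mem_Ioc]
  constructor
  · rintro ⟨y, ⟨h0, h1⟩, rfl⟩
    exact ⟨one_div_lt_one_div_of_lt (by positivity) (by linarith),
      one_div_le_one_div_of_le (by positivity) (by linarith)⟩
  · rintro ⟨h0, h1⟩
    have hx : 0 < x := lt_trans (by positivity) h0
    refine ⟨1 / x - (k + 1), ⟨?_, ?_⟩, by simp⟩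
    · have := (le_one_div hx (by positivity)).1 h1
      linarith
    · have := (one_div_lt (by positivity) hx).1 h0
      linarith

lemma iUnion_Ioc_one_div : ⋃ k : ℕ, Set.Ioc (1 / (k + 2) : ℝ) (1 / (k + 1)) = Set.Ioc 0 1 := by
  ext x
  simp only [Set.mem_iUnion, Set.mem_Ioc]
  constructor
  · rintro ⟨k, h0, h1⟩
    refine ⟨lt_trans (by positivity) h0, h1.trans ?_⟩
    rw [div_le_one (by positivity)]
    linarith [k.cast_nonneg (α := ℝ)]
  · rintro ⟨h0, h1⟩
    have h2 : 1 ≤ 1 / x := (le_one_div one_pos h0).2 (by simpa using h1)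
    have h3 : 1 ≤ ⌊1 / x⌋₊ := Nat.one_le_floor_iff _ |>.2 h2
    obtain ⟨k, hk⟩ := Nat.exists_eq_add_of_le' h3
    have h4 := Nat.floor_le (zero_le_one.trans h2)
    have h5 := Nat.lt_floor_add_one (1 / x)
    rw [hk] at h4 h5
    push_cast at h4 h5
    refine ⟨k, ?_, ?_⟩
    · rw [one_div_lt (by positivity) h0]; linarith
    · rw [le_one_div h0 (by positivity)]; linarith

lemma pairwise_disjoint_Ioc_one_div :
    Pairwise (Function.onFun Disjoint
      fun k : ℕ => Set.Ioc (1 / (k + 2) : ℝ) (1 / (k + 1))) := by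
  refine (pairwise_disjoint_on _).2 fun m n hmn => Set.disjoint_left.2 fun x hx hx' => ?_
  have h : (m : ℝ) + 1 ≤ n := by exact_mod_cast hmn
  have : 1 / ((n : ℝ) + 1) ≤ 1 / (m + 2) :=
    one_div_le_one_div_of_le (by positivity) (by linarith)
  exact absurd (hx'.2.trans this) (not_le.2 hx.1)

lemma gaussMap_inv_branch (k : ℕ) {y : ℝ} (hy : y ∈ Set.Ico (0 : ℝ) 1) :
    gaussMap (1 / (k + 1 + y)) = y := by
  rw [gaussMap, one_div_one_div, Int.fract_eq_iff]
  exact ⟨hy.1, hy.2, k + 1, by push_cast; ring⟩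

lemma gaussDensity_inv_branch (k : ℕ) {y : ℝ} (hy : 0 ≤ y) :
    1 / ((k : ℝ) + 1 + y) ^ 2 * gaussDensity (1 / (k + 1 + y)) =
      gaussDensity y * gaussWeight k y := by
  have h1 : (k : ℝ) + 1 + y ≠ 0 := by positivity
  have h2 : (k : ℝ) + 2 + y ≠ 0 := by positivity
  have h3 : 1 + y ≠ 0 := by positivity
  have h4 : Real.log 2 ≠ 0 := (Real.log_pos one_lt_two).ne'
  have h5 : 1 + 1 / ((k : ℝ) + 1 + y) = (k + 2 + y) / (k + 1 + y) := by field_simp; ring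
  rw [gaussDensity, h5, gaussDensity, gaussWeight]
  field_simp

lemma lintegral_Ioc_one_div (k : ℕ) (H : ℝ → ℝ≥0∞) :
    ∫⁻ x in Set.Ioc (1 / (k + 2) : ℝ) (1 / (k + 1)), ENNReal.ofReal (gaussDensity x) * H x =
      ∫⁻ y in Set.Ico 0 1, ENNReal.ofReal (gaussDensity y) *
        (ENNReal.ofReal (gaussWeight k y) * H (1 / (k + 1 + y))) := by
  rw [← inv_branch_image, lintegral_image_eq_lintegral_abs_deriv_mul
    (f' := fun y => -1 / ((k : ℝ) + 1 + y) ^ 2) measurableSet_Ico]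
  · refine setLIntegral_congr_fun measurableSet_Ico fun y hy => ?_
    have hy0 := hy.1
    have e : |-1 / ((k : ℝ) + 1 + y) ^ 2| = 1 / ((k : ℝ) + 1 + y) ^ 2 := by
      rw [neg_div, abs_neg, abs_of_nonneg (by positivity)]
    simp only [e]
    rw [← mul_assoc, ← mul_assoc, ← ENNReal.ofReal_mul (by positivity),
      ← ENNReal.ofReal_mul, gaussDensity_inv_branch k hy0]
    have := Real.log_pos one_lt_two
    unfold gaussDensity
    positivity
  · intro y hy
    have hy0 := hy.1
    have h : HasDerivAt (fun y : ℝ => (k : ℝ) + 1 + y) 1 y := (hasDerivAt_id y).const_add _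
    have := h.fun_inv (by positivity)
    simpa [one_div] using this.hasDerivWithinAt
  · intro x hx y hy hxy
    simpa using hxy

/-- The transfer operator is dual to composition with the Gauss map. -/
lemma lintegral_mul_comp_gaussMap {F g : ℝ → ℝ≥0∞} (hF : Measurable F) (hg : Measurable g) :
    ∫⁻ x, F x * g (gaussMap x) ∂gaussMeasure = ∫⁻ x, gaussTransferENN F x * g x ∂gaussMeasure := by
  have hd := measurable_gaussDensity
  have hG := measurable_gaussMap
  have hT := measurable_gaussTransferENN hF
  rw [lintegral_gaussMeasure (by fun_prop),
    lintegral_gaussMeasure (by fun_prop),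
    setLIntegral_congr Ioo_ae_eq_Ioc, setLIntegral_congr (Ioo_ae_eq_Ico (a := (0 : ℝ)) (b := 1)),
    ← iUnion_Ioc_one_div, lintegral_iUnion (fun _ => measurableSet_Ioc)
      pairwise_disjoint_Ioc_one_div]
  have hw := measurable_gaussWeight
  have e : ∀ y : ℝ, ENNReal.ofReal (gaussDensity y) * (gaussTransferENN F y * g y) =
      ∑' k : ℕ, ENNReal.ofReal (gaussDensity y) *
        (ENNReal.ofReal (gaussWeight k y) * (F (1 / (k + 1 + y)) * g y)) := by
    intro y
    rw [gaussTransferENN, ← ENNReal.tsum_mul_right, ← ENNReal.tsum_mul_left]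
    simp_rw [mul_assoc]
  simp_rw [e]
  rw [lintegral_tsum fun k => by have := hw k; fun_prop]
  refine tsum_congr fun k => ?_
  rw [lintegral_Ioc_one_div k fun x => F x * g (gaussMap x)]
  refine setLIntegral_congr_fun measurableSet_Ico fun y hy => ?_
  simp only [gaussMap_inv_branch k hy]

lemma measurable_iterate_gaussTransferENN {F : ℝ → ℝ≥0∞} (hF : Measurable F) (m : ℕ) :
    Measurable (gaussTransferENN^[m] F) := by
  induction m with
  | zero => exact hF
  | succ m ih =>
    rw [Function.iterate_succ_apply']
    exact measurable_gaussTransferENN ih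

lemma lintegral_mul_comp_iterate_gaussMap {F g : ℝ → ℝ≥0∞} (hF : Measurable F)
    (hg : Measurable g) (m : ℕ) :
    ∫⁻ x, F x * g (gaussMap^[m] x) ∂gaussMeasure =
      ∫⁻ x, gaussTransferENN^[m] F x * g x ∂gaussMeasure := by
  induction m generalizing g with
  | zero => rfl
  | succ m ih =>
    have h := ih (hg.comp measurable_gaussMap)
    simp only [Function.iterate_succ_apply', Function.comp_apply] at h ⊢
    rw [h, lintegral_mul_comp_gaussMap (measurable_iterate_gaussTransferENN hF m) hg]

lemma gaussMeasure_Ioc {t : ℝ} (h0 : 0 ≤ t) (h1 : t ≤ 1) :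
    gaussMeasure (Set.Ioc 0 t) = ENNReal.ofReal (Real.log (1 + t) / Real.log 2) := by
  have hl := Real.log_pos one_lt_two
  rw [gaussMeasure, withDensity_apply _ measurableSet_Ioc,
    Measure.restrict_congr_set Ioo_ae_eq_Ioc, Measure.restrict_restrict measurableSet_Ioc,
    Set.inter_eq_left.2 (Set.Ioc_subset_Ioc_right h1), ← ofReal_integral_eq_lintegral_ofReal]
  · rw [← intervalIntegral.integral_of_le h0]
    congr 1
    have e : ∀ x, gaussDensity x = (1 / Real.log 2) * (1 / (1 + x)) := fun x => by
      rw [gaussDensity, one_div_mul_one_div]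
    simp_rw [e]
    rw [intervalIntegral.integral_const_mul,
      intervalIntegral.integral_comp_add_left (fun x : ℝ => 1 / x),
      integral_one_div_of_pos (by norm_num) (by linarith)]
    simp only [add_zero, div_one]
    ring
  · have : ContinuousOn gaussDensity (Set.Icc 0 t) := by
      refine ContinuousOn.div continuousOn_const (by fun_prop) fun x hx => ?_
      have := hx.1
      positivity
    exact (this.integrableOn_Icc).mono_set Set.Ioc_subset_Icc_self
  · refine (ae_restrict_iff' measurableSet_Ioc).2 (ae_of_all _ fun x hx => ?_)
    have := hx.1
    simp only [Pi.zero_apply, gaussDensity]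
    positivity

lemma gaussMeasure_compl_Ioo : gaussMeasure (Set.Ioo 0 1)ᶜ = 0 :=
  withDensity_absolutelyContinuous _ _ (by simp [Measure.restrict_apply measurableSet_Ioo.compl])

lemma ae_gaussMeasure_mem_Ioo : ∀ᵐ x ∂gaussMeasure, x ∈ Set.Ioo (0 : ℝ) 1 :=
  gaussMeasure_compl_Ioo

instance : IsProbabilityMeasure gaussMeasure := by
  constructor
  have h : gaussMeasure Set.univ = gaussMeasure (Set.Ioc 0 1) := by
    refine measure_congr ?_
    filter_upwards [ae_gaussMeasure_mem_Ioo] with x hx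
    exact propext ⟨fun _ => Set.Ioo_subset_Ioc_self hx, fun _ => trivial⟩
  rw [h, gaussMeasure_Ioc zero_le_one le_rfl, one_add_one_eq_two,
    div_self (Real.log_pos one_lt_two).ne', ENNReal.ofReal_one]

lemma gaussTransferENN_one {x : ℝ} (hx : 0 ≤ x) : gaussTransferENN 1 x = 1 := by
  have h := hasSum_gaussWeight hx
  simp only [gaussTransferENN, Pi.one_apply, mul_one]
  rw [← ENNReal.ofReal_tsum_of_nonneg (fun k => gaussWeight_nonneg k hx) h.summable, h.tsum_eq,
    ENNReal.ofReal_one]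

lemma measurePreserving_gaussMap : MeasurePreserving gaussMap gaussMeasure gaussMeasure := by
  refine ⟨measurable_gaussMap, Measure.ext_of_lintegral _ fun g hg => ?_⟩
  rw [lintegral_map hg measurable_gaussMap]
  have h := lintegral_mul_comp_gaussMap (F := 1) measurable_one hg
  simp only [Pi.one_apply, one_mul] at h
  rw [h]
  refine lintegral_congr_ae ?_
  filter_upwards [ae_gaussMeasure_mem_Ioo] with x hx
  rw [gaussTransferENN_one hx.1.le, one_mul]

lemma volume_restrict_le_gaussMeasure :
    volume.restrict (Set.Ioo (0 : ℝ) 1) ≤ ENNReal.ofReal (2 * Real.log 2) • gaussMeasure := by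
  have hl := Real.log_pos one_lt_two
  rw [gaussMeasure, ← withDensity_smul _ measurable_gaussDensity.ennreal_ofReal]
  nth_rewrite 1 [← withDensity_one (μ := volume.restrict (Set.Ioo (0 : ℝ) 1))]
  refine withDensity_mono ((ae_restrict_iff' measurableSet_Ioo).2 (ae_of_all _ fun x hx => ?_))
  have h0 := hx.1
  simp only [Pi.one_apply, Pi.smul_apply, smul_eq_mul]
  rw [← ENNReal.ofReal_mul (by positivity), ENNReal.one_le_ofReal, gaussDensity, mul_one_div,
    one_le_div (by positivity)]
  nlinarith [hx.2]

lemma gaussTransfer_iterate_properties {f : ℝ → ℝ} {D : ℝ} {F : ℝ → ℝ≥0∞}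
    (hf0 : ∀ x ∈ Set.Icc (0 : ℝ) 1, 0 ≤ f x)
    (hf : MonotoneOn f (Set.Icc 0 1) ∨ AntitoneOn f (Set.Icc 0 1)) (hD : |f 0 - f 1| ≤ D)
    (hF : ∀ x ∈ Set.Ioo (0 : ℝ) 1, F x = ENNReal.ofReal (f x)) (m : ℕ) :
    (∀ x ∈ Set.Icc (0 : ℝ) 1, 0 ≤ gaussTransfer^[m] f x) ∧
    (MonotoneOn (gaussTransfer^[m] f) (Set.Icc 0 1) ∨
      AntitoneOn (gaussTransfer^[m] f) (Set.Icc 0 1)) ∧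
    |gaussTransfer^[m] f 0 - gaussTransfer^[m] f 1| ≤ D / 2 ^ m ∧
    ∀ x ∈ Set.Ioo (0 : ℝ) 1, gaussTransferENN^[m] F x = ENNReal.ofReal (gaussTransfer^[m] f x) := by
  induction m with
  | zero => simpa using ⟨fun x h h' => hf0 x ⟨h, h'⟩, hf, hD, fun x h h' => hF x ⟨h, h'⟩⟩
  | succ m ih =>
    simp only [Function.iterate_succ_apply']
    obtain ⟨h0, hm, hd, he⟩ := ih
    have hb : ∀ x ∈ Set.Icc (0 : ℝ) 1, gaussTransfer^[m] f x ∈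
        Set.Icc 0 (max (gaussTransfer^[m] f 0) (gaussTransfer^[m] f 1)) := by
      refine fun x hx => ⟨h0 x hx, le_max_iff.2 ?_⟩
      rcases hm with h | h
      · exact Or.inr (h hx (by simp) hx.2)
      · exact Or.inl (h (by simp) hx hx.1)
    refine ⟨fun x hx => (gaussTransfer_mem_Icc le_rfl hb hx.1).1, ?_, ?_, fun x hx => ?_⟩
    · rcases hm with h | h
      · exact Or.inr (gaussTransfer_antitoneOn h (h0 0 (by simp)))
      · exact Or.inl (gaussTransfer_monotoneOn h (h0 1 (by simp)))
    · rw [pow_succ, ← div_div]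
      exact abs_gaussTransfer_sub_le h0 hm hd
    · rw [gaussTransfer, ENNReal.ofReal_tsum_of_nonneg (fun k => mul_nonneg
        (gaussWeight_nonneg k hx.1.le) (h0 _ (inv_branch_mem_Icc k hx.1.le)))
        (summable_gaussTransfer hb hx.1.le), gaussTransferENN]
      refine tsum_congr fun k => ?_
      have hk : (1 : ℝ) < k + 1 + x := by
        have := hx.1
        have := k.cast_nonneg (α := ℝ)
        linarith
      rw [ENNReal.ofReal_mul (gaussWeight_nonneg k hx.1.le), he]
      exact ⟨by positivity, (div_lt_one (by positivity)).2 hk⟩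

/-- Exponential decay of correlations for a monotone observable. -/
lemma lintegral_mul_comp_iterate_gaussMap_le {f : ℝ → ℝ} {D : ℝ} {F g : ℝ → ℝ≥0∞}
    (hf0 : ∀ x ∈ Set.Icc (0 : ℝ) 1, 0 ≤ f x)
    (hf : MonotoneOn f (Set.Icc 0 1) ∨ AntitoneOn f (Set.Icc 0 1)) (hD : |f 0 - f 1| ≤ D)
    (hF : ∀ x ∈ Set.Ioo (0 : ℝ) 1, F x = ENNReal.ofReal (f x)) (hFm : Measurable F)
    (hg : Measurable g) (m : ℕ) :
    ∫⁻ x, F x * g (gaussMap^[m] x) ∂gaussMeasure ≤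
      (∫⁻ x, F x ∂gaussMeasure + ENNReal.ofReal (D / 2 ^ m)) * ∫⁻ x, g x ∂gaussMeasure := by
  obtain ⟨h0, hm, hd, he⟩ := gaussTransfer_iterate_properties hf0 hf hD hF m
  have hT : ∫⁻ x, gaussTransferENN^[m] F x ∂gaussMeasure = ∫⁻ x, F x ∂gaussMeasure := by
    simpa using (lintegral_mul_comp_iterate_gaussMap (g := 1) hFm measurable_one m).symm
  have hosc : ∀ x ∈ Set.Ioo (0 : ℝ) 1, ∀ y ∈ Set.Ioo (0 : ℝ) 1,
      gaussTransferENN^[m] F x ≤ gaussTransferENN^[m] F y + ENNReal.ofReal (D / 2 ^ m) := by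
    intro x hx y hy
    have hx' := Set.Ioo_subset_Icc_self hx
    have hy' := Set.Ioo_subset_Icc_self hy
    rw [he x hx, he y hy, ← ENNReal.ofReal_add (h0 y hy') ((abs_nonneg _).trans hd)]
    refine ENNReal.ofReal_le_ofReal ?_
    have hd' := abs_le.1 hd
    rcases hm with h | h
    · have h1 := h hx' (by simp) hx'.2
      have h2 := h (by simp) hy' hy'.1
      linarith
    · have h1 := h (by simp) hx' hx'.1
      have h2 := h hy' (by simp) hy'.2
      linarith
  have hsup : ∀ x ∈ Set.Ioo (0 : ℝ) 1, gaussTransferENN^[m] F x ≤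
      ∫⁻ x, F x ∂gaussMeasure + ENNReal.ofReal (D / 2 ^ m) := by
    intro x hx
    calc gaussTransferENN^[m] F x = ∫⁻ _, gaussTransferENN^[m] F x ∂gaussMeasure := by simp
      _ ≤ ∫⁻ y, (gaussTransferENN^[m] F y + ENNReal.ofReal (D / 2 ^ m)) ∂gaussMeasure := by
        refine lintegral_mono_ae ?_
        filter_upwards [ae_gaussMeasure_mem_Ioo] with y hy using hosc x hx y hy
      _ = _ := by rw [lintegral_add_right _ measurable_const, hT]; simp
  rw [lintegral_mul_comp_iterate_gaussMap hFm hg, ← lintegral_const_mul _ hg]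
  refine lintegral_mono_ae ?_
  filter_upwards [ae_gaussMeasure_mem_Ioo] with x hx
  gcongr
  exact hsup x hx

/-- The first digit of `x`, truncated at `N`. -/
noncomputable def truncDigit (N : ℕ) (x : ℝ) : ℝ := (min ⌊1 / x⌋₊ N : ℕ)

lemma truncDigit_nonneg (N : ℕ) (x : ℝ) : 0 ≤ truncDigit N x := Nat.cast_nonneg _

lemma truncDigit_le (N : ℕ) (x : ℝ) : truncDigit N x ≤ N := by
  unfold truncDigit
  exact_mod_cast min_le_right _ _

lemma measurable_truncDigit (N : ℕ) : Measurable (truncDigit N) := by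
  have h : Measurable fun x : ℝ => ⌊1 / x⌋₊ := Nat.measurable_floor.comp (by fun_prop)
  exact (measurable_from_top (f := fun k : ℕ => ((min k N : ℕ) : ℝ))).comp h

lemma le_floor_one_div_iff {k : ℕ} (hk : 1 ≤ k) {x : ℝ} (hx : 0 < x) :
    k ≤ ⌊1 / x⌋₊ ↔ x ≤ 1 / k := by
  rw [Nat.le_floor_iff (by positivity), le_one_div (by positivity) hx]

lemma memLp_truncDigit_comp (N m : ℕ) (p : ℝ≥0∞) :
    MemLp (fun x => truncDigit N (gaussMap^[m] x)) p gaussMeasure :=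
  .of_bound ((measurable_truncDigit N).comp (measurable_gaussMap.iterate m)).aestronglyMeasurable N
    (ae_of_all _ fun x => by
      rw [Real.norm_of_nonneg (truncDigit_nonneg _ _)]; exact truncDigit_le _ _)

lemma integrable_truncDigit_comp (N m : ℕ) :
    Integrable (fun x => truncDigit N (gaussMap^[m] x)) gaussMeasure :=
  (memLp_truncDigit_comp N m 1).integrable le_rfl

lemma sum_log_one_add_one_div (N : ℕ) :
    ∑ k ∈ Finset.Icc 1 N, Real.log (1 + 1 / k) = Real.log (N + 1) := by
  induction N with
  | zero => simp
  | succ N ih =>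
    rw [Finset.sum_Icc_succ_top (by lia), ih, ← Real.log_mul (by positivity) (by positivity)]
    congr 1
    push_cast
    field_simp

lemma integral_truncDigit (N : ℕ) :
    ∫ x, truncDigit N x ∂gaussMeasure = Real.log (N + 1) / Real.log 2 := by
  have h : ∀ᵐ x ∂gaussMeasure, truncDigit N x =
      ∑ k ∈ Finset.Icc 1 N, (Set.Ioc (0 : ℝ) (1 / k)).indicator 1 x := by
    filter_upwards [ae_gaussMeasure_mem_Ioo] with x hx
    have e : ∀ k ∈ Finset.Icc 1 N, (Set.Ioc (0 : ℝ) (1 / k)).indicator (1 : ℝ → ℝ) x =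
        if k ≤ ⌊1 / x⌋₊ then 1 else 0 := by
      intro k hk
      simp only [Set.indicator_apply, Set.mem_Ioc, hx.1, true_and, Pi.one_apply,
        le_floor_one_div_iff (Finset.mem_Icc.1 hk).1 hx.1]
    rw [Finset.sum_congr rfl e, Finset.sum_boole, truncDigit]
    have hs : {k ∈ Finset.Icc 1 N | k ≤ ⌊1 / x⌋₊} = Finset.Icc 1 (min ⌊1 / x⌋₊ N) := by
      ext k
      simp only [Finset.mem_filter, Finset.mem_Icc]
      lia
    rw [hs, Nat.card_Icc, Nat.add_sub_cancel]
  rw [integral_congr_ae h, integral_finsetSum]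
  · rw [← sum_log_one_add_one_div, Finset.sum_div]
    refine Finset.sum_congr rfl fun k hk => ?_
    have hk1 : (1 : ℝ) ≤ k := by exact_mod_cast (Finset.mem_Icc.1 hk).1
    have h0 : (0 : ℝ) ≤ 1 / k := by positivity
    rw [integral_indicator_one measurableSet_Ioc, measureReal_def, gaussMeasure_Ioc h0
      ((div_le_one (by positivity)).2 hk1), ENNReal.toReal_ofReal]
    exact div_nonneg (Real.log_nonneg (by linarith)) (Real.log_nonneg one_le_two)
  · exact fun k _ => (integrable_const (1 : ℝ)).indicator measurableSet_Ioc

lemma integral_comp_iterate_gaussMap {f : ℝ → ℝ} (hf : Measurable f) (m : ℕ) :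
    ∫ x, f (gaussMap^[m] x) ∂gaussMeasure = ∫ x, f x ∂gaussMeasure := by
  have h := measurePreserving_gaussMap.iterate m
  conv_rhs => rw [← h.map_eq]
  exact (integral_map h.measurable.aemeasurable hf.aestronglyMeasurable).symm

lemma integral_truncDigit_mul_comp_le (N m : ℕ) :
    ∫ x, truncDigit N x * truncDigit N (gaussMap^[m] x) ∂gaussMeasure ≤
      (Real.log (N + 1) / Real.log 2 + N * (1 / 2) ^ m) * (Real.log (N + 1) / Real.log 2) := by
  have hd := measurable_truncDigit N
  have hG := measurable_gaussMap.iterate m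
  have hi : Integrable (truncDigit N) gaussMeasure := integrable_truncDigit_comp N 0
  have hE : ∫⁻ x, ENNReal.ofReal (truncDigit N x) ∂gaussMeasure =
      ENNReal.ofReal (Real.log (N + 1) / Real.log 2) := by
    rw [← integral_truncDigit, ofReal_integral_eq_lintegral_ofReal hi
      (ae_of_all _ (truncDigit_nonneg N))]
  have he : 0 ≤ Real.log (N + 1) / Real.log 2 := by
    rw [← integral_truncDigit]; exact integral_nonneg (truncDigit_nonneg N)
  have key := lintegral_mul_comp_iterate_gaussMap_le (D := N)
    (f := fun x => if x ≤ 0 then (N : ℝ) else truncDigit N x)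
    (F := fun x => ENNReal.ofReal (truncDigit N x)) (g := fun x => ENNReal.ofReal (truncDigit N x))
    ?_ (Or.inr ?_) ?_ ?_ (by fun_prop) (by fun_prop) m
  · rw [hE, ← ENNReal.ofReal_add he (by positivity), ← ENNReal.ofReal_mul (by positivity)] at key
    simp_rw [← ENNReal.ofReal_mul (truncDigit_nonneg _ _)] at key
    rw [integral_eq_lintegral_of_nonneg_ae (ae_of_all _ fun x =>
      mul_nonneg (truncDigit_nonneg _ _) (truncDigit_nonneg _ _)) (by fun_prop)]
    rw [one_div, inv_pow, ← div_eq_mul_inv]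
    exact ENNReal.toReal_le_of_le_ofReal (by positivity) key
  · intro x _
    have := truncDigit_nonneg N x
    split_ifs <;> positivity
  · intro x hx y hy hxy
    dsimp only
    split_ifs with h1 h2 h2
    · exact le_rfl
    · exact absurd (hxy.trans h1) h2
    · exact truncDigit_le _ _
    · unfold truncDigit
      have := one_div_le_one_div_of_le (not_le.1 h2) hxy
      gcongr
  · have h0 := truncDigit_nonneg N 1
    have h1 := truncDigit_le N 1
    rw [if_pos le_rfl, if_neg (by norm_num), abs_le]
    constructor <;> linarith
  · intro x hx
    rw [if_neg (not_le.2 hx.1)]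

lemma sum_half_pow_le_two {ι : Type*} {s : Finset ι} {a : ι → ℕ} (ha : Set.InjOn a s) :
    ∑ i ∈ s, (1 / 2 : ℝ) ^ a i ≤ 2 := by
  classical
  rw [← Finset.sum_image (f := fun k => (1 / 2 : ℝ) ^ k) ha]
  exact (summable_geometric_two.sum_le_tsum _ fun k _ => by positivity).trans_eq tsum_geometric_two

lemma sum_half_pow_dist_le_four {ι : Type*} {s : Finset ι} {a : ι → ℕ} (ha : Set.InjOn a s)
    (b : ℕ) : ∑ i ∈ s, (1 / 2 : ℝ) ^ Nat.dist b (a i) ≤ 4 := by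
  rw [← Finset.sum_filter_add_sum_filter_not s fun i => a i ≤ b]
  have h1 : ∑ i ∈ s with a i ≤ b, (1 / 2 : ℝ) ^ Nat.dist b (a i) ≤ 2 := by
    refine sum_half_pow_le_two fun i hi j hj hij => ?_
    simp only [Finset.coe_filter, Set.mem_ofPred_eq] at hi hj
    refine ha hi.1 hj.1 ?_
    simp only [Nat.dist] at hij
    lia
  have h2 : ∑ i ∈ s with ¬ a i ≤ b, (1 / 2 : ℝ) ^ Nat.dist b (a i) ≤ 2 := by
    refine sum_half_pow_le_two fun i hi j hj hij => ?_
    simp only [Finset.coe_filter, Set.mem_ofPred_eq] at hi hj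
    refine ha hi.1 hj.1 ?_
    simp only [Nat.dist] at hij
    lia
  linarith

lemma integral_truncDigit_comp_mul_comp_le (N a b : ℕ) :
    ∫ x, truncDigit N (gaussMap^[a] x) * truncDigit N (gaussMap^[b] x) ∂gaussMeasure ≤
      (Real.log (N + 1) / Real.log 2 + N * (1 / 2) ^ Nat.dist a b) *
        (Real.log (N + 1) / Real.log 2) := by
  wlog h : a ≤ b generalizing a b
  · rw [Nat.dist_comm]
    simp_rw [mul_comm (truncDigit N (gaussMap^[a] _))]
    exact this b a (by lia)
  obtain ⟨m, rfl⟩ := Nat.exists_eq_add_of_le h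
  have hd := measurable_truncDigit N
  have hG := measurable_gaussMap.iterate m
  have e : Nat.dist a (a + m) = m := by simp [Nat.dist]
  rw [e]
  refine le_of_eq_of_le ?_ (integral_truncDigit_mul_comp_le N m)
  rw [← integral_comp_iterate_gaussMap
    (f := fun x => truncDigit N x * truncDigit N (gaussMap^[m] x)) (by fun_prop) a]
  simp_rw [← Function.iterate_add_apply, add_comm m a]

lemma variance_sum_truncDigit_le {ι : Type*} {s : Finset ι} {a : ι → ℕ} (ha : Set.InjOn a s)
    (N : ℕ) :
    ProbabilityTheory.variance (fun x => ∑ i ∈ s, truncDigit N (gaussMap^[a i] x)) gaussMeasure ≤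
      4 * s.card * N * (Real.log (N + 1) / Real.log 2) := by
  set e := Real.log (N + 1) / Real.log 2 with he
  have he0 : 0 ≤ e := by
    rw [he, ← integral_truncDigit]; exact integral_nonneg (truncDigit_nonneg N)
  have hL : ∀ i, MemLp (fun x => truncDigit N (gaussMap^[a i] x)) 2 gaussMeasure := fun i =>
    memLp_truncDigit_comp N (a i) 2
  have hI : ∫ x, ∑ i ∈ s, truncDigit N (gaussMap^[a i] x) ∂gaussMeasure = s.card * e := by
    rw [integral_finsetSum _ fun i _ => integrable_truncDigit_comp N (a i)]
    simp_rw [integral_comp_iterate_gaussMap (measurable_truncDigit N), integral_truncDigit]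
    simp [he]
  rw [ProbabilityTheory.variance_eq_sub (memLp_finsetSum s fun i _ => hL i), hI]
  have hsq : ∫ x, (∑ i ∈ s, truncDigit N (gaussMap^[a i] x)) ^ 2 ∂gaussMeasure ≤
      ∑ i ∈ s, ∑ j ∈ s, (e + N * (1 / 2) ^ Nat.dist (a i) (a j)) * e := by
    simp_rw [sq, Finset.sum_mul_sum]
    have hint : ∀ i j, Integrable (fun x => truncDigit N (gaussMap^[a i] x) *
        truncDigit N (gaussMap^[a j] x)) gaussMeasure := fun i j => (hL i).integrable_mul (hL j)
    rw [integral_finsetSum _ fun i _ => integrable_finsetSum _ fun j _ => hint i j]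
    refine Finset.sum_le_sum fun i _ => ?_
    rw [integral_finsetSum _ fun j _ => hint i j]
    exact Finset.sum_le_sum fun j _ => integral_truncDigit_comp_mul_comp_le N (a i) (a j)
  have hrow : ∀ i ∈ s, ∑ j ∈ s, (e + N * (1 / 2) ^ Nat.dist (a i) (a j)) * e ≤
      (s.card * e + N * 4) * e := by
    intro i _
    rw [← Finset.sum_mul, Finset.sum_add_distrib, ← Finset.mul_sum, Finset.sum_const, nsmul_eq_mul]
    gcongr
    exact sum_half_pow_dist_le_four ha _
  have h := hsq.trans (Finset.sum_le_sum hrow)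
  rw [Finset.sum_const, nsmul_eq_mul] at h
  simp only [Pi.pow_apply]
  linarith

lemma gaussMeasure_truncDigit_sum_deviation_le {ι : Type*} {s : Finset ι} {a : ι → ℕ}
    (ha : Set.InjOn a s) (N : ℕ) {c : ℝ} (hc : 0 < c) :
    gaussMeasure {x | c ≤ |∑ i ∈ s, truncDigit N (gaussMap^[a i] x) -
        s.card * (Real.log (N + 1) / Real.log 2)|} ≤
      ENNReal.ofReal (4 * s.card * N * (Real.log (N + 1) / Real.log 2) / c ^ 2) := by
  have h := ProbabilityTheory.meas_ge_le_variance_div_sq 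
    (memLp_finsetSum s fun i _ => memLp_truncDigit_comp N (a i) 2) hc
  rw [integral_finsetSum _ fun i _ => integrable_truncDigit_comp N (a i)] at h
  simp_rw [integral_comp_iterate_gaussMap (measurable_truncDigit N), integral_truncDigit,
    Finset.sum_const, nsmul_eq_mul] at h
  refine h.trans (ENNReal.ofReal_le_ofReal ?_)
  gcongr
  exact variance_sum_truncDigit_le ha N

lemma gaussMeasure_lt_floor_le (N m : ℕ) :
    gaussMeasure {x | N < ⌊1 / gaussMap^[m] x⌋₊} ≤
      ENNReal.ofReal (1 / ((N + 1) * Real.log 2)) := by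
  have hl := Real.log_pos one_lt_two
  have hS : MeasurableSet {x : ℝ | N < ⌊1 / x⌋₊} := by
    have h : Measurable fun x : ℝ => ⌊1 / x⌋₊ := Nat.measurable_floor.comp (by fun_prop)
    exact measurableSet_lt measurable_const h
  have h0 : (0 : ℝ) ≤ 1 / (N + 1 : ℕ) := by positivity
  calc gaussMeasure {x | N < ⌊1 / gaussMap^[m] x⌋₊}
      = gaussMeasure {x : ℝ | N < ⌊1 / x⌋₊} :=
        (measurePreserving_gaussMap.iterate m).measure_preimage hS.nullMeasurableSet
    _ ≤ gaussMeasure (Set.Ioc 0 (1 / (N + 1 : ℕ))) := by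
        refine measure_mono_ae ?_
        filter_upwards [ae_gaussMeasure_mem_Ioo] with x hx h
        exact ⟨hx.1, (le_floor_one_div_iff N.succ_pos hx.1).1 h⟩
    _ ≤ _ := by
        rw [gaussMeasure_Ioc h0]
        · refine ENNReal.ofReal_le_ofReal ?_
          rw [← div_div]
          gcongr
          have := Real.log_le_sub_one_of_pos (x := 1 + 1 / ((N + 1 : ℕ) : ℝ)) (by positivity)
          push_cast at this ⊢
          linarith
        · rw [div_le_one (by positivity)]
          exact_mod_cast N.succ_pos

/-- Deviation bound for sums of digits, obtained by truncating the digits at `N`. -/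
lemma gaussMeasure_sum_deviation_le {ι : Type*} {s : Finset ι} {a : ι → ℕ}
    (ha : Set.InjOn a s) (N : ℕ) {c : ℝ} (hc : 0 < c) :
    gaussMeasure {x | c ≤ |∑ i ∈ s, (⌊1 / gaussMap^[a i] x⌋₊ : ℝ) -
        s.card * (Real.log (N + 1) / Real.log 2)|} ≤
      ENNReal.ofReal (4 * s.card * N * (Real.log (N + 1) / Real.log 2) / c ^ 2 +
        s.card / ((N + 1) * Real.log 2)) := by
  have hl := Real.log_pos one_lt_two
  have hlN : 0 ≤ Real.log (N + 1) := Real.log_nonneg (by linarith [N.cast_nonneg (α := ℝ)])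
  rw [ENNReal.ofReal_add (by positivity) (by positivity)]
  have hsub : {x | c ≤ |∑ i ∈ s, (⌊1 / gaussMap^[a i] x⌋₊ : ℝ) -
        s.card * (Real.log (N + 1) / Real.log 2)|} ⊆
      {x | c ≤ |∑ i ∈ s, truncDigit N (gaussMap^[a i] x) -
        s.card * (Real.log (N + 1) / Real.log 2)|} ∪
      ⋃ i ∈ s, {x | N < ⌊1 / gaussMap^[a i] x⌋₊} := by
    intro x hx
    by_cases h : ∃ i ∈ s, N < ⌊1 / gaussMap^[a i] x⌋₊
    · right
      simpa using h
    · left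
      push Not at h
      have e : ∑ i ∈ s, truncDigit N (gaussMap^[a i] x) =
          ∑ i ∈ s, (⌊1 / gaussMap^[a i] x⌋₊ : ℝ) :=
        Finset.sum_congr rfl fun i hi => by rw [truncDigit, min_eq_left (h i hi)]
      rwa [Set.mem_ofPred_eq, e]
  refine (measure_mono hsub).trans ((measure_union_le _ _).trans ?_)
  gcongr
  · exact gaussMeasure_truncDigit_sum_deviation_le ha N hc
  · refine (measure_biUnion_finset_le _ _).trans
      ((Finset.sum_le_sum fun i _ => gaussMeasure_lt_floor_le N (a i)).trans_eq ?_)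
    rw [Finset.sum_const, nsmul_eq_mul, ← ENNReal.ofReal_natCast,
      ← ENNReal.ofReal_mul (by positivity), mul_one_div]

lemma tendsto_log_mul_add_one_div_log {L : ℕ} (hL : 0 < L) :
    Tendsto (fun n : ℕ => Real.log ((n * L : ℕ) + 1) / Real.log n) atTop (nhds 1) := by
  have hL1 : (1 : ℝ) ≤ L := by exact_mod_cast hL
  have hlog : Tendsto (fun n : ℕ => Real.log n) atTop atTop :=
    tendsto_log_atTop.comp tendsto_natCast_atTop_atTop
  have hup : Tendsto (fun n : ℕ => 1 + Real.log (L + 1) / Real.log n) atTop (nhds 1) := by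
    simpa using (hlog.const_div_atTop (Real.log (L + 1))).const_add 1
  refine tendsto_of_tendsto_of_tendsto_of_le_of_le' tendsto_const_nhds hup ?_ ?_
  all_goals
    filter_upwards [eventually_ge_atTop 2] with n hn
    have hn2 : (2 : ℝ) ≤ n := by exact_mod_cast hn
    have hpos : 0 < Real.log n := Real.log_pos (by linarith)
  · rw [one_le_div hpos]
    refine Real.log_le_log (by linarith) ?_
    push_cast
    nlinarith
  · have e : 1 + Real.log (L + 1) / Real.log n = Real.log (n * (L + 1)) / Real.log n := by
      rw [Real.log_mul (by positivity) (by positivity), add_div, div_self hpos.ne']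
    rw [e]
    gcongr
    push_cast
    nlinarith

/-- For any strictly increasing `Λ : ℕ → ℕ`, the normalized sums
`(1/(n log n)) ∑_{i=1}^n a_{Λ(i)}(x)` converge to `1/log 2` in measure. -/
theorem rcf_subsequence_mean_in_measure (Λ : ℕ → ℕ) (hΛ : StrictMono Λ) :
    ∀ ε > (0 : ℝ), Tendsto
      (fun n : ℕ => volume {x : ℝ | x ∈ Set.Ioo (0 : ℝ) 1 ∧ Irrational x ∧
        |(1 / (n * Real.log n)) * ∑ i ∈ Finset.Icc 1 n, (rcfDigit x (Λ i) : ℝ) -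
          1 / Real.log 2| > ε})
      atTop (nhds 0) := by
  intro ε hε
  have hl := Real.log_pos one_lt_two
  have hlog : Tendsto (fun n : ℕ => Real.log n) atTop atTop :=
    tendsto_log_atTop.comp tendsto_natCast_atTop_atTop
  have hinj : ∀ n, Set.InjOn (fun i => Λ i - 1) (Finset.Icc 1 n : Finset ℕ) := by
    intro n i hi j hj hij
    have hi1 := (Finset.mem_Icc.1 hi).1.trans (hΛ.le_apply (x := i))
    have hj1 := (Finset.mem_Icc.1 hj).1.trans (hΛ.le_apply (x := j))
    exact hΛ.injective (by lia)
  rw [ENNReal.tendsto_nhds_zero]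
  intro δ hδ
  obtain ⟨η, hη0, hηδ⟩ : ∃ η : ℝ, 0 < η ∧ ENNReal.ofReal (2 * Real.log 2 * η) ≤ δ := by
    obtain ⟨r, hr0, hr⟩ := ENNReal.lt_iff_exists_nnreal_btwn.1 hδ
    have hr0' : (0 : ℝ) < r := by exact_mod_cast hr0
    refine ⟨r / (2 * Real.log 2), by positivity, ?_⟩
    rw [mul_div_cancel₀ _ (by positivity), ENNReal.ofReal_coe_nnreal]
    exact hr.le
  obtain ⟨L, hL⟩ := exists_nat_gt (2 / (Real.log 2 * η))
  have hL0' : (0 : ℝ) < L := lt_of_le_of_lt (by positivity) hL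
  have hL0 : 0 < L := by exact_mod_cast hL0'
  have hr := tendsto_log_mul_add_one_div_log hL0
  have hmean : Tendsto (fun n : ℕ => Real.log ((n * L : ℕ) + 1) / Real.log n / Real.log 2)
      atTop (nhds (1 / Real.log 2)) := hr.div_const _
  have hvar : Tendsto (fun n : ℕ => 16 * L / (ε ^ 2 * Real.log 2) *
      (Real.log ((n * L : ℕ) + 1) / Real.log n * (1 / Real.log n))) atTop (nhds 0) := by
    simpa using (hr.mul (hlog.const_div_atTop 1)).const_mul (16 * L / (ε ^ 2 * Real.log 2))
  filter_upwards [eventually_ge_atTop 2, Metric.tendsto_nhds.1 hmean (ε / 2) (by positivity),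
    hvar.eventually_le_const (half_pos hη0)] with n hn hmean_n hvar_n
  have hn2 : (2 : ℝ) ≤ n := by exact_mod_cast hn
  have hn0 : (0 : ℝ) < n := by linarith
  have hpos : 0 < Real.log n := Real.log_pos (by linarith)
  have hc : 0 < ε / 2 * (n * Real.log n) := by positivity
  set E : ℝ := Real.log ((n * L : ℕ) + 1) / Real.log 2 with hE
  rw [Real.dist_eq, div_right_comm, ← hE] at hmean_n
  set B : Set ℝ := {x | ε / 2 * (n * Real.log n) ≤
    |∑ i ∈ Finset.Icc 1 n, (⌊1 / gaussMap^[Λ i - 1] x⌋₊ : ℝ) - (Finset.Icc 1 n).card * E|} with hB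
  have hBle : gaussMeasure B ≤ ENNReal.ofReal η := by
    refine (gaussMeasure_sum_deviation_le (hinj n) (n * L) hc).trans (ENNReal.ofReal_le_ofReal ?_)
    rw [← hE, Nat.card_Icc, Nat.add_sub_cancel]
    have h1 : 4 * n * (n * L : ℕ) * E / (ε / 2 * (n * Real.log n)) ^ 2 ≤ η / 2 := by
      refine le_of_eq_of_le ?_ hvar_n
      rw [hE]
      push_cast
      field_simp
      ring
    have h2 : n / (((n * L : ℕ) + 1) * Real.log 2) ≤ η / 2 := by
      rw [div_lt_iff₀ (by positivity)] at hL
      rw [div_le_div_iff₀ (by positivity) two_pos]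
      push_cast
      have : 0 < η * Real.log 2 := by positivity
      nlinarith
    linarith
  have hsub : {x : ℝ | x ∈ Set.Ioo (0 : ℝ) 1 ∧ Irrational x ∧
      |(1 / (n * Real.log n)) * ∑ i ∈ Finset.Icc 1 n, (rcfDigit x (Λ i) : ℝ) -
        1 / Real.log 2| > ε} ⊆ B ∩ Set.Ioo 0 1 := by
    rintro x ⟨hx, -, hdev⟩
    refine ⟨?_, hx⟩
    simp only [rcfDigit, Int.floor_toNat] at hdev
    rw [hB, Set.mem_ofPred_eq, Nat.card_Icc, Nat.add_sub_cancel]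
    set S := ∑ i ∈ Finset.Icc 1 n, (⌊1 / gaussMap^[Λ i - 1] x⌋₊ : ℝ)
    have e : |S - n * E| = |1 / (n * Real.log n) * S - E / Real.log n| * (n * Real.log n) := by
      rw [← abs_of_pos (show 0 < n * Real.log n by positivity), ← abs_mul,
        abs_of_pos (show 0 < n * Real.log n by positivity)]
      congr 1
      field_simp
    rw [e]
    gcongr
    have := abs_sub_le (1 / (n * Real.log n) * S) (E / Real.log n) (1 / Real.log 2)
    linarith
  calc volume {x : ℝ | x ∈ Set.Ioo (0 : ℝ) 1 ∧ Irrational x ∧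
      |(1 / (n * Real.log n)) * ∑ i ∈ Finset.Icc 1 n, (rcfDigit x (Λ i) : ℝ) -
        1 / Real.log 2| > ε} ≤ volume (B ∩ Set.Ioo 0 1) := measure_mono hsub
    _ = volume.restrict (Set.Ioo (0 : ℝ) 1) B := (Measure.restrict_apply' measurableSet_Ioo).symm
    _ ≤ (ENNReal.ofReal (2 * Real.log 2) • gaussMeasure) B := volume_restrict_le_gaussMeasure B
    _ ≤ ENNReal.ofReal (2 * Real.log 2) * ENNReal.ofReal η := by
        rw [Measure.smul_apply, smul_eq_mul]
        gcongr
    _ = ENNReal.ofReal (2 * Real.log 2 * η) := (ENNReal.ofReal_mul (by positivity)).symm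
    _ ≤ δ := hηδ
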